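/- arXiv:2305.10202 — 4 statements merged into one kernel-verified Lean document; each statement's English description precedes it below -/
import Mathlib

section
/- Let R be a commutative Noetherian ring, 𝔞 an ideal of R, and 𝒮 a Serre subcategory of the category of R-modules. If M is an R-module such that the submodule (0 :_M 𝔞) = {m ∈ M : 𝔞·m = 0} belongs to 𝒮, then for every integer l ≥ 1 the submodule (0 :_M 𝔞^l) = {m ∈ M : 𝔞^l·m = 0} belongs to 𝒮. -/
universe u

/-- A Serre subcategory of the category of `R`-modules: a class of `R`-modules,
closed under isomorphism, submodules, quotient modules and extensions. -/
structure SerreClass (R : Type u) [CommRing R] : Type (u + 1) where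
  mem : ∀ (M : Type u) [AddCommGroup M] [Module R M], Prop
  mem_of_linearEquiv :
    ∀ (M N : Type u) [AddCommGroup M] [Module R M] [AddCommGroup N] [Module R N],
      (M ≃ₗ[R] N) → mem M → mem N
  mem_submodule :
    ∀ (M : Type u) [AddCommGroup M] [Module R M] (N : Submodule R M), mem M → mem N
  mem_quotient :
    ∀ (M : Type u) [AddCommGroup M] [Module R M] (N : Submodule R M), mem M → mem (M ⧸ N)
  mem_extension :
    ∀ (M : Type u) [AddCommGroup M] [Module R M] (N : Submodule R M),
      mem N → mem (M ⧸ N) → mem M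

namespace SerreClass

variable {R : Type u} [CommRing R] (𝒮 : SerreClass R)
  {M N : Type u} [AddCommGroup M] [Module R M] [AddCommGroup N] [Module R N]

theorem mem_of_injective (f : M →ₗ[R] N) (hf : Function.Injective f) (hN : 𝒮.mem N) :
    𝒮.mem M :=
  𝒮.mem_of_linearEquiv _ _ (LinearEquiv.ofInjective f hf).symm (𝒮.mem_submodule N _ hN)

theorem mem_of_mem_ker (f : M →ₗ[R] N) (hker : 𝒮.mem (LinearMap.ker f)) (hN : 𝒮.mem N) :
    𝒮.mem M :=
  𝒮.mem_extension M (LinearMap.ker f) hker <|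
    𝒮.mem_of_linearEquiv _ _ f.quotKerEquivRange.symm (𝒮.mem_submodule N _ hN)

theorem mem_pi_fin (hN : 𝒮.mem N) (n : ℕ) : 𝒮.mem (Fin n → N) := by
  induction n with
  | zero =>
    exact 𝒮.mem_of_injective (0 : (Fin 0 → N) →ₗ[R] N)
      (Function.injective_of_subsingleton _) hN
  | succ n ih =>
    refine 𝒮.mem_of_mem_ker (LinearMap.proj (0 : Fin (n + 1)) : (Fin (n + 1) → N) →ₗ[R] N)
      (𝒮.mem_of_injective
        (LinearMap.funLeft R N Fin.succ ∘ₗ Submodule.subtype _) ?_ ih) hN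
    rintro ⟨x, hx⟩ ⟨y, hy⟩ hxy
    ext i
    refine Fin.cases ?_ (fun j => ?_) i
    · exact Eq.trans hx (Eq.symm hy)
    · exact congrFun hxy j

/-- If `𝔟` is finitely generated, then `(0 :_M 𝔞 * 𝔟)` is an extension of a submodule of a
finite power of `(0 :_M 𝔞)` by a submodule of `(0 :_M 𝔟)`. -/
theorem mem_torsionBySet_mul {𝔞 𝔟 : Ideal R} (hfg : 𝔟.FG)
    (ha : 𝒮.mem (Submodule.torsionBySet R M (𝔞 : Set R)))
    (hb : 𝒮.mem (Submodule.torsionBySet R M (𝔟 : Set R))) :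
    𝒮.mem (Submodule.torsionBySet R M ((𝔞 * 𝔟 : Ideal R) : Set R)) := by
  obtain ⟨n, g, hg⟩ := Submodule.fg_iff_exists_fin_generating_family.mp hfg
  have hgb (i : Fin n) : g i ∈ 𝔟 := hg ▸ Submodule.subset_span ⟨i, rfl⟩
  let f : Submodule.torsionBySet R M ((𝔞 * 𝔟 : Ideal R) : Set R) →ₗ[R]
      Fin n → Submodule.torsionBySet R M (𝔞 : Set R) :=
    LinearMap.pi fun i =>
      ((LinearMap.lsmul R M (g i)).comp (Submodule.subtype _)).codRestrict _ fun x => by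
        rw [Submodule.mem_torsionBySet_iff]
        rintro ⟨a, ha⟩
        have := (Submodule.mem_torsionBySet_iff _ _).mp x.2
          ⟨a * g i, Ideal.mul_mem_mul ha (hgb i)⟩
        simpa [mul_smul] using this
  have hker (x : LinearMap.ker f) :
      (x : M) ∈ Submodule.torsionBySet R M (𝔟 : Set R) := by
    have hspan : Submodule.torsionBySet R M (𝔟 : Set R) =
        Submodule.torsionBySet R M (Set.range g) := by
      rw [← hg]
      exact (Submodule.torsionBySet_eq_torsionBySet_span _).symm
    rw [hspan, Submodule.mem_torsionBySet_iff]
    rintro ⟨_, i, rfl⟩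
    exact congrArg Subtype.val (congrFun x.2 i)
  refine 𝒮.mem_of_mem_ker f (𝒮.mem_of_injective
    (((Submodule.subtype _).comp (Submodule.subtype _)).codRestrict _ hker) ?_ hb)
    (𝒮.mem_pi_fin ha n)
  intro x y hxy
  have hval := congrArg Subtype.val hxy
  exact Subtype.ext (Subtype.ext hval)

end SerreClass

/-- If `(0 :_M 𝔞) ∈ 𝒮` then `(0 :_M 𝔞^l) ∈ 𝒮` for all `l ≥ 1`. -/
theorem serre_mem_torsionBySet_pow
    (R : Type u) [CommRing R] [IsNoetherianRing R] (𝔞 : Ideal R) (𝒮 : SerreClass R)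
    (M : Type u) [AddCommGroup M] [Module R M]
    (h : 𝒮.mem (Submodule.torsionBySet R M (𝔞 : Set R)))
    (l : ℕ) (hl : 1 ≤ l) :
    𝒮.mem (Submodule.torsionBySet R M ((𝔞 ^ l : Ideal R) : Set R)) := by
  induction l, hl using Nat.le_induction with
  | base => rwa [pow_one]
  | succ l _ ih =>
    rw [pow_succ']
    exact 𝒮.mem_torsionBySet_mul (IsNoetherian.noetherian _) h ih
end

section
/- Let R be a commutative Noetherian ring, 𝔞 an ideal of R, and 𝒮 a Serre subcategory of the category of R-modules. If M is an R-module such that the quotient module M/𝔞M belongs to 𝒮, then for every integer l ≥ 1 the quotient module M/𝔞^l M belongs to 𝒮. -/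
universe u

namespace SerreClass

variable {R : Type u} [CommRing R] (𝒮 : SerreClass R)

theorem mem_of_surjective {M N : Type u} [AddCommGroup M] [Module R M] [AddCommGroup N]
    [Module R N] (f : M →ₗ[R] N) (hf : Function.Surjective f) (h : 𝒮.mem M) : 𝒮.mem N :=
  𝒮.mem_of_linearEquiv _ _ (f.quotKerEquivOfSurjective hf) (𝒮.mem_quotient _ _ h)

theorem mem_range {M N : Type u} [AddCommGroup M] [Module R M] [AddCommGroup N]
    [Module R N] (f : M →ₗ[R] N) (h : 𝒮.mem M) : 𝒮.mem (LinearMap.range f) :=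
  𝒮.mem_of_surjective f.rangeRestrict f.surjective_rangeRestrict h

theorem mem_sup {M : Type u} [AddCommGroup M] [Module R M] {A B : Submodule R M}
    (hA : 𝒮.mem A) (hB : 𝒮.mem B) : 𝒮.mem (A ⊔ B : Submodule R M) := by
  refine 𝒮.mem_extension _ (B.submoduleOf (A ⊔ B)) ?_ ?_
  · exact 𝒮.mem_of_linearEquiv _ _ (Submodule.submoduleOfEquivOfLe le_sup_right).symm hB
  · exact 𝒮.mem_of_linearEquiv _ _ (LinearMap.quotientInfEquivSupQuotient A B)
      (𝒮.mem_quotient _ _ hA)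

/-- If multiplication by each element of a finitely generated ideal `I` on `X` has image in `𝒮`,
then `I X` is in `𝒮`. -/
theorem mem_smul_top {X : Type u} [AddCommGroup X] [Module R X] {I : Ideal R} (hI : I.FG)
    (h : ∀ r ∈ I, 𝒮.mem (LinearMap.range (LinearMap.lsmul R X r))) :
    𝒮.mem (I • (⊤ : Submodule R X) : Submodule R X) := by
  induction I, hI using Submodule.fg_induction with
  | singleton r =>
    have key : (Submodule.span R {r} : Ideal R) • (⊤ : Submodule R X) =
        LinearMap.range (LinearMap.lsmul R X r) := by
      ext x
      simp [Submodule.ideal_span_singleton_smul, Submodule.mem_smul_pointwise_iff_exists]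
    rw [key]
    exact h r (Submodule.mem_span_singleton_self r)
  | sup I J _ _ ihI ihJ =>
    rw [Submodule.sup_smul]
    exact 𝒮.mem_sup (ihI fun r hr => h r (Submodule.mem_sup_left hr))
      (ihJ fun r hr => h r (Submodule.mem_sup_right hr))

theorem mem_quotient_smul {M : Type u} [AddCommGroup M] [Module R M] {I : Ideal R} (hI : I.FG)
    {N : Submodule R M} (hM : 𝒮.mem (M ⧸ (I • (⊤ : Submodule R M)))) (hN : 𝒮.mem (M ⧸ N)) :
    𝒮.mem (M ⧸ (I • N)) := by
  refine 𝒮.mem_extension _ (I • ⊤) (𝒮.mem_smul_top hI fun r hr => ?_) ?_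
  · let f : (M ⧸ N) →ₗ[R] (M ⧸ (I • N)) :=
      N.mapQ (I • N) (LinearMap.lsmul R M r) fun n hn => Submodule.smul_mem_smul hr hn
    have hf : LinearMap.range f = LinearMap.range (LinearMap.lsmul R (M ⧸ (I • N)) r) := by
      rw [← LinearMap.range_comp_of_range_eq_top f N.range_mkQ,
        ← LinearMap.range_comp_of_range_eq_top (LinearMap.lsmul R (M ⧸ (I • N)) r)
          (I • N).range_mkQ]
      rfl
    exact hf ▸ 𝒮.mem_range f hN
  · refine 𝒮.mem_of_surjective ((I • (⊤ : Submodule R M)).mapQ (I • ⊤) (I • N).mkQ ?_) ?_ hM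
    · rw [← Submodule.map_le_iff_le_comap, Submodule.map_smul'']
      exact Submodule.smul_mono le_rfl le_top
    · intro x
      obtain ⟨y, rfl⟩ := Submodule.mkQ_surjective _ x
      obtain ⟨m, rfl⟩ := Submodule.mkQ_surjective _ y
      exact ⟨Submodule.Quotient.mk m, rfl⟩

end SerreClass

/-- If `M/𝔞M ∈ 𝒮` then `M/𝔞^l M ∈ 𝒮` for all `l ≥ 1`. -/
theorem serre_mem_quotient_smul_pow
    (R : Type u) [CommRing R] [IsNoetherianRing R] (𝔞 : Ideal R) (𝒮 : SerreClass R)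
    (M : Type u) [AddCommGroup M] [Module R M]
    (h : 𝒮.mem (M ⧸ (𝔞 • (⊤ : Submodule R M))))
    (l : ℕ) (hl : 1 ≤ l) :
    𝒮.mem (M ⧸ (𝔞 ^ l • (⊤ : Submodule R M))) := by
  induction l, hl using Nat.le_induction with
  | base => rwa [pow_one]
  | succ l _ ih =>
    rw [pow_succ', Submodule.mul_smul]
    exact 𝒮.mem_quotient_smul (IsNoetherian.noetherian 𝔞) h ih
end

section
/- Let R be a commutative Noetherian ring, 𝔞 an ideal of R, 𝒮 a Serre subcategory of the category of R-modules, and 𝒞 a class of R-modules satisfying: (1) 𝒮 ⊆ 𝒞; (2) for each M ∈ 𝒞 the submodule (0 :_M 𝔞) belongs to 𝒮; (3) whenever 0 → M' → M → M'' → 0 is a short exact sequence of R-modules with M' and M in 𝒞, also M'' is in 𝒞. Let f : M → N be an R-linear map with M and N in 𝒞, and suppose 𝔞^l · Ker f = 0 for some l ≥ 1. Then Ker f belongs to 𝒮 (hence also to 𝒞) and Coker f belongs to 𝒞. -/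
universe u

namespace SerreClass

variable {R : Type u} [CommRing R] (𝒮 : SerreClass R)
  {A B : Type u} [AddCommGroup A] [Module R A] [AddCommGroup B] [Module R B]

theorem mem_of_injective_s3 (g : A →ₗ[R] B) (hg : Function.Injective g) (hB : 𝒮.mem B) :
    𝒮.mem A :=
  𝒮.mem_of_linearEquiv _ _ (LinearEquiv.ofInjective g hg).symm (𝒮.mem_submodule _ _ hB)

theorem mem_torsionBySet_of_injective (s : Set R) (g : A →ₗ[R] B) (hg : Function.Injective g)
    (hB : 𝒮.mem (Submodule.torsionBySet R B s)) : 𝒮.mem (Submodule.torsionBySet R A s) := by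
  refine 𝒮.mem_of_injective_s3 ((g.comp (Submodule.subtype _)).codRestrict _ ?_) ?_ hB
  · rintro ⟨x, hx⟩
    rw [Submodule.mem_torsionBySet_iff] at hx ⊢
    exact fun b => (g.map_smul _ _).symm.trans ((congrArg g (hx b)).trans g.map_zero)
  · exact fun x y h => Subtype.ext (hg (congrArg Subtype.val h))

theorem mem_of_mem_ker_s3 (g : A →ₗ[R] B) (hg : 𝒮.mem (LinearMap.ker g)) (hB : 𝒮.mem B) :
    𝒮.mem A :=
  𝒮.mem_extension _ _ hg <|
    𝒮.mem_of_linearEquiv _ _ g.quotKerEquivRange.symm (𝒮.mem_submodule _ _ hB)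

theorem mem_fin_pi (hA : 𝒮.mem A) (k : ℕ) : 𝒮.mem (Fin k → A) := by
  induction k with
  | zero => exact 𝒮.mem_of_injective_s3 (0 : _ →ₗ[R] A) (Function.injective_of_subsingleton _) hA
  | succ k ih =>
    refine 𝒮.mem_of_mem_ker_s3 (LinearMap.proj 0) (𝒮.mem_of_injective_s3
      ((LinearMap.funLeft R A Fin.succ).comp (Submodule.subtype _)) ?_ ih) hA
    rintro ⟨x, hx⟩ ⟨y, hy⟩ h
    ext i
    refine Fin.cases ?_ (fun j => congrFun h j) i
    exact (LinearMap.mem_ker.mp hx).trans (LinearMap.mem_ker.mp hy).symm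

/-- A module killed by a power of a finitely generated ideal `𝔞` lies in a Serre class
as soon as its submodule `(0 : 𝔞)` does. -/
theorem mem_of_pow_smul_eq_zero {𝔞 : Ideal R} (h𝔞 : 𝔞.FG) (n : ℕ)
    (hA : 𝒮.mem (Submodule.torsionBySet R A (𝔞 : Set R)))
    (hn : ∀ a ∈ 𝔞 ^ n, ∀ x : A, a • x = 0) : 𝒮.mem A := by
  induction n generalizing A with
  | zero =>
    have : Subsingleton A :=
      subsingleton_of_forall_eq 0 fun x => by simpa using hn 1 (by simp) x
    exact 𝒮.mem_of_injective_s3 (0 : A →ₗ[R] _) (Function.injective_of_subsingleton _) hA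
  | succ n ih =>
    obtain ⟨k, a, rfl⟩ := Submodule.fg_iff_exists_fin_generating_family.mp h𝔞
    set 𝔞 := Submodule.span R (Set.range a)
    let T := Submodule.torsionBySet R A ((𝔞 ^ n : Ideal R) : Set R)
    have hT : 𝒮.mem T :=
      ih (𝒮.mem_torsionBySet_of_injective _ T.subtype (Submodule.injective_subtype _) hA)
        fun b hb x => Subtype.ext ((Submodule.mem_torsionBySet_iff _ _).mp x.2 ⟨b, hb⟩)
    have ha (i : Fin k) : a i ∈ 𝔞 := Submodule.subset_span ⟨i, rfl⟩
    let g : A →ₗ[R] (Fin k → T) := LinearMap.pi fun i =>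
      (LinearMap.lsmul R A (a i)).codRestrict T fun x => by
        rw [Submodule.mem_torsionBySet_iff]
        rintro ⟨b, hb⟩
        have := hn (b * a i) (pow_succ 𝔞 n ▸ Ideal.mul_mem_mul hb (ha i)) x
        rwa [mul_smul] at this
    refine 𝒮.mem_of_mem_ker_s3 g (𝒮.mem_of_injective_s3 (Submodule.inclusion ?_)
      (Submodule.inclusion_injective _) hA) (𝒮.mem_fin_pi hT k)
    intro x hx
    have hle : 𝔞 ≤ LinearMap.ker (LinearMap.toSpanSingleton R A x) := by
      refine Submodule.span_le.mpr ?_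
      rintro _ ⟨i, rfl⟩
      exact congrArg Subtype.val (congrFun (LinearMap.mem_ker.mp hx) i)
    exact (Submodule.mem_torsionBySet_iff _ _).mpr fun b => hle b.2

end SerreClass

/-- Lemma 2.4: kernels annihilated by a power of `𝔞` and cokernels,
for a class `𝒞` containing `𝒮`, with `(0 :_M 𝔞) ∈ 𝒮` for `M ∈ 𝒞`, and such that in any short
exact sequence with the first two terms in `𝒞`, the third term lies in `𝒞`. -/
theorem ker_mem_serre_and_coker_mem
    (R : Type u) [CommRing R] [IsNoetherianRing R] (𝔞 : Ideal R) (𝒮 : SerreClass R)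
    (𝒞 : ∀ (M : Type u) [AddCommGroup M] [Module R M], Prop)
    (h1 : ∀ (M : Type u) [AddCommGroup M] [Module R M], 𝒮.mem M → 𝒞 M)
    (h2 : ∀ (M : Type u) [AddCommGroup M] [Module R M],
      𝒞 M → 𝒮.mem (Submodule.torsionBySet R M (𝔞 : Set R)))
    (h3 : ∀ (A B C : Type u) [AddCommGroup A] [Module R A] [AddCommGroup B] [Module R B]
      [AddCommGroup C] [Module R C] (f : A →ₗ[R] B) (g : B →ₗ[R] C),
      Function.Injective f → Function.Surjective g → Function.Exact f g → 𝒞 A → 𝒞 B → 𝒞 C)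
    (M N : Type u) [AddCommGroup M] [Module R M] [AddCommGroup N] [Module R N]
    (hM : 𝒞 M) (hN : 𝒞 N) (f : M →ₗ[R] N)
    (l : ℕ) (hl : 1 ≤ l) (hker : ∀ a ∈ 𝔞 ^ l, ∀ x ∈ LinearMap.ker f, a • x = 0) :
    𝒮.mem (LinearMap.ker f) ∧ 𝒞 (LinearMap.ker f) ∧ 𝒞 (N ⧸ LinearMap.range f) := by
  have hK : 𝒮.mem (LinearMap.ker f) :=
    𝒮.mem_of_pow_smul_eq_zero (IsNoetherian.noetherian 𝔞) l
      (𝒮.mem_torsionBySet_of_injective _ (LinearMap.ker f).subtype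
        (Submodule.injective_subtype _) (h2 M hM))
      fun a ha x => Subtype.ext (hker a ha x x.2)
  have hrange : 𝒞 (LinearMap.range f) :=
    h3 _ _ _ (LinearMap.ker f).subtype f.rangeRestrict (Submodule.injective_subtype _)
      f.surjective_rangeRestrict
      (LinearMap.exact_iff.mpr (by rw [LinearMap.ker_rangeRestrict, Submodule.range_subtype]))
      (h1 _ hK) hM
  exact ⟨hK, h1 _ hK, h3 _ _ _ (LinearMap.range f).subtype (LinearMap.range f).mkQ
    (Submodule.injective_subtype _) (Submodule.mkQ_surjective _)
    (LinearMap.exact_subtype_mkQ _) hrange hN⟩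
end

section
/- Let R be a commutative Noetherian ring, 𝔞 an ideal of R, 𝒮 a Serre subcategory of the category of R-modules, and 𝒞 a class of R-modules satisfying: (1) 𝒮 ⊆ 𝒞; (2) for each M ∈ 𝒞 the quotient M/𝔞M belongs to 𝒮; (3) whenever 0 → M' → M → M'' → 0 is a short exact sequence of R-modules with M and M'' in 𝒞, also M' is in 𝒞. Let f : M → N be an R-linear map with M and N in 𝒞, and suppose 𝔞^l · Coker f = 0 for some l ≥ 1. Then Ker f and Coker f belong to 𝒞. -/
universe u

namespace SerreClass

variable {R : Type u} [CommRing R] (𝒮 : SerreClass R)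
  {A B C : Type u} [AddCommGroup A] [Module R A] [AddCommGroup B] [Module R B]
  [AddCommGroup C] [Module R C]

theorem mem_of_surjective_s6 (f : A →ₗ[R] B) (hf : Function.Surjective f) (hA : 𝒮.mem A) :
    𝒮.mem B :=
  𝒮.mem_of_linearEquiv _ _ (f.quotKerEquivOfSurjective hf) (𝒮.mem_quotient _ _ hA)

theorem mem_of_exact (f : A →ₗ[R] B) (g : B →ₗ[R] C) (hfg : Function.Exact f g)
    (hA : 𝒮.mem A) (hC : 𝒮.mem C) : 𝒮.mem B := by
  refine 𝒮.mem_extension B (LinearMap.ker g) ?_ ?_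
  · rw [hfg.linearMap_ker_eq]
    exact 𝒮.mem_of_surjective_s6 f.rangeRestrict f.surjective_rangeRestrict hA
  · exact 𝒮.mem_of_linearEquiv _ _ g.quotKerEquivRange.symm (𝒮.mem_submodule _ _ hC)

theorem mem_prod (hA : 𝒮.mem A) (hB : 𝒮.mem B) : 𝒮.mem (A × B) :=
  𝒮.mem_of_exact (LinearMap.inl R A B) (LinearMap.snd R A B) Function.Exact.inl_snd hA hB

theorem mem_sup_s6 (P Q : Submodule R A) (hP : 𝒮.mem P) (hQ : 𝒮.mem Q) :
    𝒮.mem (P ⊔ Q : Submodule R A) := by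
  have h := 𝒮.mem_of_surjective_s6 (P.subtype.coprod Q.subtype).rangeRestrict
    (LinearMap.surjective_rangeRestrict _) (𝒮.mem_prod hP hQ)
  rwa [LinearMap.range_coprod, Submodule.range_subtype, Submodule.range_subtype] at h

/-- If `A / 𝔞A` lies in a Serre class, `I` is finitely generated, and `I𝔞A` is killed by
`g : A → B`, then `g(IA)` lies in the Serre class. -/
theorem mem_map_smul_top {𝔞 I : Ideal R} (hI : I.FG)
    (hA : 𝒮.mem (A ⧸ (𝔞 • ⊤ : Submodule R A))) (g : A →ₗ[R] B)
    (hg : I • (𝔞 • ⊤ : Submodule R A) ≤ LinearMap.ker g) :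
    𝒮.mem ((I • ⊤ : Submodule R A).map g) := by
  induction I, hI using Submodule.fg_induction with
  | singleton a =>
    have hker : (𝔞 • ⊤ : Submodule R A) ≤ LinearMap.ker (a • g) := fun x hx => by
      simpa using hg (Submodule.smul_mem_smul (Submodule.mem_span_singleton_self a) hx)
    have h := 𝒮.mem_of_surjective_s6 (Submodule.liftQ _ (a • g) hker).rangeRestrict
      (LinearMap.surjective_rangeRestrict _) hA
    have heq : LinearMap.range (Submodule.liftQ _ (a • g) hker) =
        ((R ∙ a : Ideal R) • ⊤ : Submodule R A).map g := by
      rw [Submodule.range_liftQ]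
      ext y
      simp [Submodule.ideal_span_singleton_smul, Submodule.mem_smul_pointwise_iff_exists]
    rwa [heq] at h
  | sup I J _ _ hI hJ =>
    rw [Submodule.sup_smul, sup_le_iff] at hg
    rw [Submodule.sup_smul, Submodule.map_sup]
    exact 𝒮.mem_sup_s6 _ _ (hI hg.1) (hJ hg.2)

theorem mem_quotient_pow_smul_top [IsNoetherianRing R] {𝔞 : Ideal R}
    (hA : 𝒮.mem (A ⧸ (𝔞 • ⊤ : Submodule R A))) (k : ℕ) :
    𝒮.mem (A ⧸ (𝔞 ^ k • ⊤ : Submodule R A)) := by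
  induction k with
  | zero =>
    refine 𝒮.mem_of_surjective_s6 (Submodule.factor ?_) (Submodule.factor_surjective _) hA
    simp
  | succ k ih =>
    have hle : (𝔞 ^ (k + 1) • ⊤ : Submodule R A) ≤ 𝔞 ^ k • ⊤ :=
      Submodule.smul_mono_left (Ideal.pow_le_pow_right k.le_succ)
    have hmap := 𝒮.mem_map_smul_top (IsNoetherian.noetherian (𝔞 ^ k)) hA
      (Submodule.mkQ (𝔞 ^ (k + 1) • ⊤ : Submodule R A))
      (by rw [Submodule.ker_mkQ, pow_succ, Submodule.mul_smul])
    refine 𝒮.mem_of_exact (Submodule.subtype _) (Submodule.factor hle) ?_ hmap ih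
    rw [LinearMap.exact_iff, Submodule.range_subtype, Submodule.factor, Submodule.mapQ,
      Submodule.ker_liftQ]
    simp

end SerreClass

/-- Lemma 2.7: for a class `𝒞` containing `𝒮`, with `M/𝔞M ∈ 𝒮` for `M ∈ 𝒞`, and closed under
kernels of surjections between members (third property below), a map between members of `𝒞`
whose cokernel is annihilated by a power of `𝔞` has kernel and cokernel in `𝒞`. -/
theorem ker_and_coker_mem_of_coker_annihilated
    (R : Type u) [CommRing R] [IsNoetherianRing R] (𝔞 : Ideal R) (𝒮 : SerreClass R)
    (𝒞 : ∀ (M : Type u) [AddCommGroup M] [Module R M], Prop)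
    (h1 : ∀ (M : Type u) [AddCommGroup M] [Module R M], 𝒮.mem M → 𝒞 M)
    (h2 : ∀ (M : Type u) [AddCommGroup M] [Module R M],
      𝒞 M → 𝒮.mem (M ⧸ (𝔞 • (⊤ : Submodule R M))))
    (h3 : ∀ (A B C : Type u) [AddCommGroup A] [Module R A] [AddCommGroup B] [Module R B]
      [AddCommGroup C] [Module R C] (f : A →ₗ[R] B) (g : B →ₗ[R] C),
      Function.Injective f → Function.Surjective g → Function.Exact f g → 𝒞 B → 𝒞 C → 𝒞 A)
    (M N : Type u) [AddCommGroup M] [Module R M] [AddCommGroup N] [Module R N]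
    (hM : 𝒞 M) (hN : 𝒞 N) (f : M →ₗ[R] N)
    (l : ℕ) (hl : 1 ≤ l)
    (hcoker : ∀ a ∈ 𝔞 ^ l, ∀ y : N ⧸ LinearMap.range f, a • y = 0) :
    𝒞 (LinearMap.ker f) ∧ 𝒞 (N ⧸ LinearMap.range f) := by
  have hcok : 𝒞 (N ⧸ LinearMap.range f) := by
    refine h1 _ (𝒮.mem_of_surjective_s6 (Submodule.factor ?_) (Submodule.factor_surjective _)
      (𝒮.mem_quotient_pow_smul_top (h2 N hN) l))
    refine Submodule.smul_le.2 fun a ha y _ => ?_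
    rw [← Submodule.Quotient.mk_eq_zero, Submodule.Quotient.mk_smul]
    exact hcoker a ha _
  have hrange : 𝒞 (LinearMap.range f) :=
    h3 _ _ _ (LinearMap.range f).subtype (LinearMap.range f).mkQ
      (Submodule.injective_subtype _) (Submodule.mkQ_surjective _)
      (LinearMap.exact_subtype_mkQ _) hN hcok
  refine ⟨?_, hcok⟩
  refine h3 _ _ _ (LinearMap.ker f).subtype f.rangeRestrict (Submodule.injective_subtype _)
    f.surjective_rangeRestrict ?_ hM hrange
  rw [LinearMap.exact_iff, LinearMap.ker_rangeRestrict, Submodule.range_subtype]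
end
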